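/- Let $m,n$ be positive integers with $m>n$, $m$ even and $n$ odd. Then $\{(a,c)\in\mathbb{R}^2:\exists\,b\in\mathbb{R},\ \vertiii{(a,b,c)}_{m,n}=1\}=\{(a,c)\in[-1,1]^2:|a+c|\le 1\}$; that is, the projection $\pi_{ac}(a,b,c)=(a,c)$ maps the unit sphere $\mathsf{S}^h_{m,n}$ onto the hexagon $\Pi=\{(a,c)\in[-1,1]^2:|a+c|\le 1\}$. -/

import Mathlib

open Set

/-- The homogeneous trinomial norm `⦀(a,b,c)⦀_{m,n}`:
the sup of `|a x^m + b x^{m-n} y^n + c y^m|` over the unit square. -/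
noncomputable def homNorm (m n : ℕ) (a b c : ℝ) : ℝ :=
  sSup ((fun p : ℝ × ℝ => |a * p.1 ^ m + b * p.1 ^ (m - n) * p.2 ^ n + c * p.2 ^ m|) ''
    (Icc (-1 : ℝ) 1 ×ˢ Icc (-1 : ℝ) 1))

lemma le_homNorm (m n : ℕ) (a b c : ℝ) {x y : ℝ} (hx : x ∈ Icc (-1 : ℝ) 1)
    (hy : y ∈ Icc (-1 : ℝ) 1) :
    |a * x ^ m + b * x ^ (m - n) * y ^ n + c * y ^ m| ≤ homNorm m n a b c := by
  refine le_csSup ?_ ⟨(x, y), ⟨hx, hy⟩, rfl⟩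
  exact ((isCompact_Icc.prod isCompact_Icc).image (by fun_prop)).bddAbove

lemma homNorm_le (m n : ℕ) (a b c : ℝ) {K : ℝ}
    (h : ∀ x ∈ Icc (-1 : ℝ) 1, ∀ y ∈ Icc (-1 : ℝ) 1,
      |a * x ^ m + b * x ^ (m - n) * y ^ n + c * y ^ m| ≤ K) :
    homNorm m n a b c ≤ K := by
  refine csSup_le ⟨_, ⟨((0 : ℝ), (0 : ℝ)), ⟨by simp, by simp⟩, rfl⟩⟩ ?_
  rintro _ ⟨⟨x, y⟩, ⟨hx, hy⟩, rfl⟩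
  exact h x hx y hy

lemma lipschitzWith_homNorm_middle (m n : ℕ) (a c : ℝ) :
    LipschitzWith 1 (fun b => homNorm m n a b c) := by
  refine LipschitzWith.of_le_add fun b b' => homNorm_le m n a b c fun x hx y hy => ?_
  have hle := le_homNorm m n a b' c hx hy
  have hx1 : |x ^ (m - n)| ≤ 1 := by
    rw [abs_pow]; exact pow_le_one₀ (abs_nonneg x) (abs_le.2 hx)
  have hy1 : |y ^ n| ≤ 1 := by
    rw [abs_pow]; exact pow_le_one₀ (abs_nonneg y) (abs_le.2 hy)
  have hxy : |(b - b') * (x ^ (m - n) * y ^ n)| ≤ |b - b'| := by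
    rw [abs_mul, abs_mul]
    exact mul_le_of_le_one_right (abs_nonneg _) (mul_le_one₀ hx1 (abs_nonneg _) hy1)
  calc |a * x ^ m + b * x ^ (m - n) * y ^ n + c * y ^ m|
      = |(a * x ^ m + b' * x ^ (m - n) * y ^ n + c * y ^ m)
          + (b - b') * (x ^ (m - n) * y ^ n)| := by ring_nf
    _ ≤ _ := abs_add_le _ _
    _ ≤ homNorm m n a b' c + dist b b' := add_le_add hle hxy

lemma abs_mul_add_mul_le_one {a c u v : ℝ} (ha : a ∈ Icc (-1 : ℝ) 1) (hc : c ∈ Icc (-1 : ℝ) 1)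
    (hac : |a + c| ≤ 1) (hu : u ∈ Icc (0 : ℝ) 1) (hv : v ∈ Icc (0 : ℝ) 1) :
    |a * u + c * v| ≤ 1 := by
  obtain ⟨ha1, ha2⟩ := ha
  obtain ⟨hc1, hc2⟩ := hc
  obtain ⟨hu1, hu2⟩ := hu
  obtain ⟨hv1, hv2⟩ := hv
  obtain ⟨h1, h2⟩ := abs_le.1 hac
  rw [abs_le]
  rcases le_total u v with h | h
  · constructor <;> nlinarith
  · constructor <;> nlinarith

theorem stmt16 (m n : ℕ) (hm : Even m) (hn : Odd n) (hmn : n < m) :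
    {p : ℝ × ℝ | ∃ b : ℝ, homNorm m n p.1 b p.2 = 1} =
      {p : ℝ × ℝ | p.1 ∈ Icc (-1 : ℝ) 1 ∧ p.2 ∈ Icc (-1 : ℝ) 1 ∧ |p.1 + p.2| ≤ 1} := by
  have hm0 : m ≠ 0 := by omega
  have hn0 : n ≠ 0 := by rintro rfl; simp at hn
  have hk0 : m - n ≠ 0 := by omega
  ext ⟨a, c⟩
  simp only [mem_ofPred_eq]
  constructor
  · rintro ⟨b, hb⟩
    have h10 := le_homNorm m n a b c (x := 1) (y := 0) (by simp) (by simp)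
    have h01 := le_homNorm m n a b c (x := 0) (y := 1) (by simp) (by simp)
    have h11 := le_homNorm m n a b c (x := 1) (y := 1) (by simp) (by simp)
    have h12 := le_homNorm m n a b c (x := 1) (y := -1) (by simp) (by simp)
    simp only [hb, one_pow, zero_pow hm0, zero_pow hn0, zero_pow hk0, hm.neg_one_pow,
      hn.neg_one_pow, mul_one, mul_zero, add_zero, zero_add] at h10 h01 h11 h12
    refine ⟨abs_le.1 h10, abs_le.1 h01, ?_⟩
    rw [abs_le] at *
    constructor <;> linarith
  · rintro ⟨ha, hc, hac⟩
    have h0 : homNorm m n a 0 c ≤ 1 := by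
      refine homNorm_le m n a 0 c fun x hx y hy => ?_
      have mem_pow {t : ℝ} (ht : t ∈ Icc (-1 : ℝ) 1) : t ^ m ∈ Icc (0 : ℝ) 1 :=
        ⟨hm.pow_nonneg t, by
          rw [← hm.pow_abs]; exact pow_le_one₀ (abs_nonneg t) (abs_le.2 ht)⟩
      simpa using abs_mul_add_mul_le_one ha hc hac (mem_pow hx) (mem_pow hy)
    have h2 : 1 ≤ homNorm m n a 2 c := by
      have h11 := le_homNorm m n a 2 c (x := 1) (y := 1) (by simp) (by simp)
      simp only [one_pow, mul_one] at h11
      linarith [le_abs_self (a + 2 + c), (abs_le.1 hac).1]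
    exact mem_range_of_exists_le_of_exists_ge
      (lipschitzWith_homNorm_middle m n a c).continuous ⟨0, h0⟩ ⟨2, h2⟩
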